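/- arXiv:1211.5217 — 3 statements merged into one kernel-verified Lean document; each statement's English description precedes it below -/
import Mathlib

section
/- Let a, b > 0 with a − 2b > 0 and let f₀ ∈ (√(a/2), √(a−b)). If (f̄, ḡ) ∈ 𝒜 and |f̄| ≥ f₀, then H(f̄, ḡ) > 0. -/
open Real Set Filter Topology

noncomputable section

/-- The Hamiltonian energy `H(f,g) = ½ f²(1−g²) + (a/4) g⁴ − (b/2) g²`. -/
def Ham (a b f g : ℝ) : ℝ := 1 / 2 * f ^ 2 * (1 - g ^ 2) + a / 4 * g ^ 4 - b / 2 * g ^ 2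

/-- The set `𝒜` of admissible points. -/
def Aadm (a b : ℝ) : Set (ℝ × ℝ) :=
  {p | 2 * p.1 ^ 2 - a * p.2 ^ 2 - (a - 2 * b) ≤ 0 ∧ p.2 ^ 2 ≤ 1}

/-- `φ` is an admissible cutoff function `φ_η`. -/
def IsCutoff (a b η : ℝ) (φ : ℝ → ℝ → ℝ) : Prop :=
  (∀ f g, φ f g ∈ Icc (0 : ℝ) 1) ∧
  ContDiffOn ℝ (⊤ : ℕ∞) (fun p : ℝ × ℝ => φ p.1 p.2)
    (Ioo (-Real.sqrt (a - b)) (Real.sqrt (a - b)) ×ˢ (univ : Set ℝ)) ∧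
  (∀ f g, φ f g = φ |f| |g|) ∧
  (∀ f g, Real.sqrt (a - b) - η / 2 ≤ |f| → φ f g = 0) ∧
  (∀ f g, |f| ≤ Real.sqrt (a - b) - η → φ f g = 1)

/-- `(f, g)` is a `C¹` solution on `s` of the original Cauchy problem
`f' + (2/r) f = g(f² − a g² + b)`, `g' = f(1 − g²)`, `f(0) = 0`, `g(0) = x`. -/
def IsSolOn (a b x : ℝ) (f g : ℝ → ℝ) (s : Set ℝ) : Prop :=
  f 0 = 0 ∧ g 0 = x ∧ ContinuousOn f s ∧ ContinuousOn g s ∧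
  ∀ r ∈ s, 0 < r →
    HasDerivAt f (g r * ((f r) ^ 2 - a * (g r) ^ 2 + b) - 2 / r * f r) r ∧
    HasDerivAt g (f r * (1 - (g r) ^ 2)) r

/-- `(f, g)` is a `C¹` solution on `s` of the regularized Cauchy problem
`f' + (2 φ(f,g)/r) f = g(f² − a g² + b)`, `g' = f(1 − g²)`, `f(0) = 0`, `g(0) = x`. -/
def IsRegSolOn (a b : ℝ) (φ : ℝ → ℝ → ℝ) (x : ℝ) (f g : ℝ → ℝ) (s : Set ℝ) : Prop :=
  f 0 = 0 ∧ g 0 = x ∧ ContinuousOn f s ∧ ContinuousOn g s ∧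
  ∀ r ∈ s, 0 < r →
    HasDerivAt f (g r * ((f r) ^ 2 - a * (g r) ^ 2 + b) - 2 * φ (f r) (g r) / r * f r) r ∧
    HasDerivAt g (f r * (1 - (g r) ^ 2)) r

/-- `(f, g)` is a solution on `s` of the autonomous (Hamiltonian) system
`f' = g(f² − a g² + b)`, `g' = f(1 − g²)` with initial data `(fi, gi)`. -/
def IsAutSolOn (a b fi gi : ℝ) (f g : ℝ → ℝ) (s : Set ℝ) : Prop :=
  f 0 = fi ∧ g 0 = gi ∧ ContinuousOn f s ∧ ContinuousOn g s ∧
  ∀ r ∈ s,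
    HasDerivAt f (g r * ((f r) ^ 2 - a * (g r) ^ 2 + b)) r ∧
    HasDerivAt g (f r * (1 - (g r) ^ 2)) r

/-- `(f, g)` is a solution on `s` of the shifted regularized system
`f' + (2 φ(f,g)/(ρ+r)) f = g(f² − a g² + b)`, `g' = f(1 − g²)` with initial data `(fi, gi)`. -/
def IsShiftSolOn (a b : ℝ) (φ : ℝ → ℝ → ℝ) (ρ fi gi : ℝ) (f g : ℝ → ℝ) (s : Set ℝ) : Prop :=
  f 0 = fi ∧ g 0 = gi ∧ ContinuousOn f s ∧ ContinuousOn g s ∧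
  ∀ r ∈ s,
    HasDerivAt f (g r * ((f r) ^ 2 - a * (g r) ^ 2 + b) - 2 * φ (f r) (g r) / (ρ + r) * f r) r ∧
    HasDerivAt g (f r * (1 - (g r) ^ 2)) r

/-- The interval `[0, R)` with possibly infinite right endpoint. -/
def edom (R : EReal) : Set ℝ := {r : ℝ | 0 ≤ r ∧ (r : EReal) < R}

/-- `g` changes sign at `r₀` relative to the interval `s`. -/
def ChangesSignAt (g : ℝ → ℝ) (s : Set ℝ) (r₀ : ℝ) : Prop :=
  g r₀ = 0 ∧ ∃ ε > 0, Icc (r₀ - ε) (r₀ + ε) ⊆ s ∧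
    g (r₀ - ε) * g (r₀ + ε) < 0 ∧ ∀ r ∈ Ioo (0 : ℝ) ε, g (r₀ - r) * g (r₀ + r) ≤ 0

/-- `g` changes sign exactly `k` times on `s`. -/
def ChangesSignExactly (g : ℝ → ℝ) (s : Set ℝ) (k : ℕ) : Prop :=
  {r | ChangesSignAt g s r}.Finite ∧ {r | ChangesSignAt g s r}.ncard = k

/-- The set `A_k`, for the family of solutions `x ↦ (F x, G x)`. -/
def Aset (a b : ℝ) (F G : ℝ → ℝ → ℝ) (k : ℕ) : Set ℝ :=
  {x | x ∈ Ioo (0 : ℝ) 1 ∧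
    (∃ L, L < 0 ∧ Tendsto (fun r => Ham a b (F x r) (G x r)) atTop (nhds L)) ∧
    ChangesSignExactly (G x) (Ioi 0) k}

/-- The set `I_k`, for the family of solutions `x ↦ (F x, G x)`. -/
def Iset (a b : ℝ) (F G : ℝ → ℝ → ℝ) (k : ℕ) : Set ℝ :=
  {x | x ∈ Ioo (0 : ℝ) 1 ∧
    Tendsto (fun r => (F x r, G x r)) atTop (nhds ((0 : ℝ), (0 : ℝ))) ∧
    ChangesSignExactly (G x) (Ioi 0) k}

/-- Lemma A.2: admissible points with `|f| ≥ f₀ > √(a/2)` have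
positive energy. -/
theorem positive_energy_in_corner (a b f₀ : ℝ) (hb : 0 < b) (hab : 2 * b < a)
    (hf₀ : f₀ ∈ Ioo (Real.sqrt (a / 2)) (Real.sqrt (a - b)))
    (fb gb : ℝ) (hmem : (fb, gb) ∈ Aadm a b) (hf : f₀ ≤ |fb|) :
    0 < Ham a b fb gb := by
  have hF : a / 2 < fb ^ 2 := by
    rw [← sq_abs]
    exact Real.lt_sq_of_sqrt_lt (hf₀.1.trans_le hf)
  have hG : gb ^ 2 ≤ 1 := hmem.2
  have hprod : 0 ≤ (fb ^ 2 - a / 2) * (1 - gb ^ 2) :=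
    mul_nonneg (by linarith) (by linarith)
  have hpos : 0 < a * (1 - gb ^ 2) ^ 2 + (a - 2 * b) * gb ^ 2 := by
    have ha : 0 < a := by linarith
    have hd : 0 < a - 2 * b := by linarith
    rcases eq_or_ne gb 0 with rfl | hg
    · simpa using ha
    · positivity
  unfold Ham
  linarith
end
end

section
/- Let a, b > 0 with a − 2b > 0, η ∈ (0, √(a−b) − √(a/2)), φ_η an admissible cutoff, x ∈ (0,1), and let (f_{x,η}, g_{x,η}) be the solution of the regularized system with f_{x,η}(0) = 0, g_{x,η}(0) = x. If (f_{x,η}, g_{x,η})(r) converges to (0, √(b/a)) or to (0, −√(b/a)) as r → +∞, then f_{x,η} has infinitely many zeros on (0, +∞). -/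
open Real Set Filter Topology

noncomputable section

/-- A real function cannot satisfy the Riccati-type inequality `u' ≥ δ (1 + u²)` on a half-line. -/
lemma not_forall_riccati_le_deriv {δ R : ℝ} (hδ : 0 < δ) (u u' : ℝ → ℝ)
    (hu : ∀ r, R ≤ r → HasDerivAt u (u' r) r) (hle : ∀ r, R ≤ r → δ * (1 + u r ^ 2) ≤ u' r) :
    False := by
  have hd : ∀ r, R ≤ r → HasDerivAt (fun r => arctan (u r)) (1 / (1 + u r ^ 2) * u' r) r :=
    fun r hr => (hu r hr).arctan
  have hN : 0 < π / δ := div_pos pi_pos hδ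
  obtain ⟨t, ht, hslope⟩ := exists_hasDerivAt_eq_slope (fun r => arctan (u r))
    (fun r => 1 / (1 + u r ^ 2) * u' r) (lt_add_of_pos_right R hN)
    (fun r hr => (hd r hr.1).continuousAt.continuousWithinAt) (fun r hr => hd r hr.1.le)
  have hpos : 0 < 1 + u t ^ 2 := by positivity
  have hge : δ ≤ 1 / (1 + u t ^ 2) * u' t := by
    rw [one_div_mul_eq_div, le_div_iff₀ hpos]
    exact hle t ht.1.le
  rw [hslope, add_sub_cancel_left, le_div_iff₀ hN, mul_div_cancel₀ _ hδ.ne'] at hge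
  linarith [arctan_lt_pi_div_two (u (R + π / δ)), neg_pi_div_two_lt_arctan (u R)]

/-- A trajectory of the damped system `f' = g (f² - a g² + b) - (2 / r) f`, `g' = f (1 - g²)`
converging to an equilibrium `(0, c)` with `a c² = b` cannot have `f` eventually nonvanishing. -/
lemma not_eventually_ne_zero_of_tendsto_equilibrium {a b c : ℝ} (hb : 0 < b) (hab : 2 * b < a)
    (hc : a * c ^ 2 = b) {f g : ℝ → ℝ}
    (hf : ∀ᶠ r in atTop,
      HasDerivAt f (g r * ((f r) ^ 2 - a * (g r) ^ 2 + b) - 2 / r * f r) r)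
    (hg : ∀ᶠ r in atTop, HasDerivAt g (f r * (1 - (g r) ^ 2)) r)
    (hf0 : Tendsto f atTop (𝓝 0)) (hgc : Tendsto g atTop (𝓝 c)) :
    ¬ ∀ᶠ r in atTop, f r ≠ 0 := by
  intro hne
  have hc2 : c ^ 2 < 1 / 2 := by nlinarith
  have hg_sq : ∀ᶠ r in atTop, 1 / 2 < 1 - g r ^ 2 :=
    (tendsto_const_nhds.sub (hgc.pow 2)).eventually_const_lt (by linarith)
  have hgne : ∀ᶠ r in atTop, g r ≠ c := by
    obtain ⟨R, hR⟩ := eventually_atTop.1 ((hne.and hg).and hg_sq)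
    have key : ∀ s t, R ≤ s → s < t → g s = c → g t ≠ c := by
      intro s t hs hst h1 h2
      obtain ⟨z, hz, hz0⟩ := exists_hasDerivAt_eq_zero hst
        (fun r hr => (hR r (hs.trans hr.1)).1.2.continuousAt.continuousWithinAt)
        (h1.trans h2.symm) (fun r hr => (hR r (hs.trans hr.1.le)).1.2)
      have h := hR z (hs.trans hz.1.le)
      exact mul_ne_zero h.1.1 (by linarith [h.2]) hz0
    by_cases h : ∃ s, R ≤ s ∧ g s = c
    · obtain ⟨s, hs, hsc⟩ := h
      filter_upwards [eventually_gt_atTop s] with t ht using key s t hs ht hsc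
    · filter_upwards [eventually_ge_atTop R] with t ht heq using h ⟨t, ht, heq⟩
  set m := min b (1 / 2) with hm
  have hm0 : 0 < m := lt_min hb (by norm_num)
  have hgg : ∀ᶠ r in atTop, m < a * (g r * (g r + c)) := by
    refine Tendsto.eventually_const_lt (u := m) ?_
      (((hgc.mul (hgc.add_const c)).const_mul a))
    have : a * (c * (c + c)) = 2 * b := by rw [← hc]; ring
    rw [this]
    linarith [min_le_left b (1 / 2)]
  have hsmall : ∀ᶠ r in atTop, |g r * f r - 2 / r| < m := by
    have h : Tendsto (fun r => |g r * f r - 2 / r|) atTop (𝓝 |c * 0 - 0|) :=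
      ((hgc.mul hf0).sub (tendsto_const_nhds.div_atTop tendsto_id)).abs
    exact h.eventually_lt_const (by simpa using hm0)
  obtain ⟨R, hR⟩ := eventually_atTop.1
    (hf.and (hg.and (hg_sq.and (hgne.and (hgg.and hsmall)))))
  refine not_forall_riccati_le_deriv (half_pos hm0) (fun r => f r / (c - g r))
    (fun r => (g r * f r - 2 / r) * (f r / (c - g r)) + a * (g r * (g r + c))
      + (1 - g r ^ 2) * (f r / (c - g r)) ^ 2) (R := R) ?_ ?_
  · intro r hr
    obtain ⟨h1, h2, -, h4, -⟩ := hR r hr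
    have hk : c - g r ≠ 0 := sub_ne_zero.2 h4.symm
    refine (h1.div (h2.const_sub c) hk).congr_deriv ?_
    rw [← hc]
    generalize 2 / r = w
    field_simp
    ring
  · intro r hr
    obtain ⟨-, -, h3, -, h5, h6⟩ := hR r hr
    generalize f r / (c - g r) = u
    have hlin : -(m * |u|) ≤ (g r * f r - 2 / r) * u := by
      have := neg_abs_le ((g r * f r - 2 / r) * u)
      rw [abs_mul] at this
      nlinarith [mul_le_mul_of_nonneg_right h6.le (abs_nonneg u)]
    have hquad : m * u ^ 2 ≤ (1 - g r ^ 2) * u ^ 2 :=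
      mul_le_mul_of_nonneg_right ((min_le_right b (1 / 2)).trans h3.le) (sq_nonneg u)
    have hsq : m * (2 * |u|) ≤ m * (1 + u ^ 2) :=
      mul_le_mul_of_nonneg_left (by nlinarith [sq_nonneg (|u| - 1), sq_abs u]) hm0.le
    linarith

/-- Remark 2.5: if the solution of the regularized system tends to
`(0, ±√(b/a))`, then `f_{x,η}` has infinitely many zeros. -/
theorem f_infinitely_many_zeros (a b η : ℝ) (hb : 0 < b) (hab : 2 * b < a)
    (hη : η ∈ Ioo 0 (Real.sqrt (a - b) - Real.sqrt (a / 2)))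
    (φ : ℝ → ℝ → ℝ) (hφ : IsCutoff a b η φ)
    (x : ℝ) (hx : x ∈ Ioo (0 : ℝ) 1)
    (f g : ℝ → ℝ) (hsol : IsRegSolOn a b φ x f g (Ici 0))
    (hconv :
      Tendsto (fun r => (f r, g r)) atTop (nhds ((0 : ℝ), Real.sqrt (b / a))) ∨
      Tendsto (fun r => (f r, g r)) atTop (nhds ((0 : ℝ), -Real.sqrt (b / a)))) :
    {r | r ∈ Ioi (0 : ℝ) ∧ f r = 0}.Infinite := by
  have ha : 0 < a := by linarith
  obtain ⟨c, hc, hlim⟩ : ∃ c, a * c ^ 2 = b ∧ Tendsto (fun r => (f r, g r)) atTop (𝓝 (0, c)) := by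
    have hs : a * √(b / a) ^ 2 = b := by
      rw [sq_sqrt (by positivity), mul_div_cancel₀ _ ha.ne']
    rcases hconv with h | h
    · exact ⟨_, hs, h⟩
    · exact ⟨_, by rwa [neg_sq], h⟩
  have hf0 : Tendsto f atTop (𝓝 0) := (continuous_fst.tendsto _).comp hlim
  have hgc : Tendsto g atTop (𝓝 c) := (continuous_snd.tendsto _).comp hlim
  have hφ1 : ∀ᶠ r in atTop, φ (f r) (g r) = 1 := by
    have hpos : |(0 : ℝ)| < √(a - b) - η := by
      rw [abs_zero]
      linarith [hη.2, sqrt_nonneg (a / 2)]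
    filter_upwards [hf0.abs.eventually_lt_const hpos] with r hr using hφ.2.2.2.2 _ _ hr.le
  obtain ⟨-, -, -, -, hode⟩ := hsol
  intro hfin
  refine not_eventually_ne_zero_of_tendsto_equilibrium hb hab hc ?_ ?_ hf0 hgc ?_
  · filter_upwards [hφ1, eventually_gt_atTop 0] with r h1 hr
    simpa [h1] using (hode r hr.le hr).1
  · filter_upwards [eventually_gt_atTop 0] with r hr using (hode r hr.le hr).2
  · obtain ⟨B, hB⟩ := hfin.bddAbove
    filter_upwards [eventually_gt_atTop B, eventually_gt_atTop 0] with r hrB hr h0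
    exact hrB.not_ge (hB ⟨hr, h0⟩)
end
end

section
/- Let a, b > 0 with a − 2b > 0, x ∈ (0,1), and let (f, g) be a global solution of the system f' + (2/r)f = g(f² − a g² + b), g' = f(1 − g²) with f(0) = 0, g(0) = x, such that H(f, g)(r) > 0 for all r > 0 and g has exactly k zeros 0 < r₁ < … < r_k on (0, +∞), with (f, g)(r) → (0,0) as r → +∞. Then f also has exactly k zeros on (0, +∞); more precisely, for each i = 1, …, k, f has exactly i − 1 zeros on (0, r_i), and f has exactly one zero on (r_k, +∞). -/
open Real Set Filter Topology

noncomputable section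

/-- A function that starts nonpositive and has negative derivative at each of its zeros is
negative from then on. -/
lemma neg_of_deriv_neg_at_zeros {φ φ' : ℝ → ℝ} {s t : ℝ} (hst : s < t) (hs : φ s ≤ 0)
    (hd : ∀ r ∈ Icc s t, HasDerivAt φ (φ' r) r) (hz : ∀ r ∈ Icc s t, φ r = 0 → φ' r < 0) :
    φ t < 0 := by
  have hc : ContinuousOn φ (Icc s t) := fun r hr => (hd r hr).continuousAt.continuousWithinAt
  have hle : ∀ r ∈ Icc s t, φ r ≤ 0 := fun r hr =>
    image_le_of_deriv_right_lt_deriv_boundary' (B := fun _ => 0) (B' := fun _ => 0) hc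
      (fun r hr => (hd r (Ico_subset_Icc_self hr)).hasDerivWithinAt) hs continuousOn_const
      (fun r _ => hasDerivWithinAt_const r _ (0 : ℝ))
      (fun r hr h => hz r (Ico_subset_Icc_self hr) h) hr
  have ht : t ∈ Icc s t := right_mem_Icc.2 hst.le
  refine lt_of_le_of_ne (hle t ht) fun h0 => ?_
  have hslope := (hasDerivAt_iff_tendsto_slope.1 (hd t ht)).mono_left
    (nhdsWithin_mono t (fun r (hr : r ∈ Iio t) => (ne_of_lt hr : r ≠ t)))
  have hev := hslope.eventually (gt_mem_nhds (hz t ht h0))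
  obtain ⟨r, hr, hrs⟩ := (hev.and (Ioo_mem_nhdsLT hst)).exists
  have h1 := hle r ⟨hrs.1.le, hrs.2.le⟩
  rw [slope_def_field, h0, sub_zero] at hr
  have : 0 ≤ φ r / (r - t) := div_nonneg_of_nonpos h1 (by linarith [hrs.2])
  linarith

lemma Ham_neg (a b f g : ℝ) : Ham a b (-f) (-g) = Ham a b f g := by
  unfold Ham
  ring

/-- The system is invariant under `(f, g) ↦ (-f, -g)`. -/
lemma IsSolOn.neg {a b x : ℝ} {f g : ℝ → ℝ} {s : Set ℝ} (h : IsSolOn a b x f g s) :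
    IsSolOn a b (-x) (-f) (-g) s := by
  obtain ⟨h1, h2, h3, h4, h5⟩ := h
  refine ⟨by simp [h1], by simp [h2], h3.neg, h4.neg, fun r hr hr0 => ?_⟩
  obtain ⟨hf, hg⟩ := h5 r hr hr0
  constructor
  · refine hf.neg.congr_deriv ?_
    simp only [Pi.neg_apply]
    ring
  · refine hg.neg.congr_deriv ?_
    simp only [Pi.neg_apply]
    ring

/-- A zero of `f` at positive energy lies where `a g² > 2 b`. -/
lemma two_mul_lt_of_Ham_pos {a b g : ℝ} (h : 0 < Ham a b 0 g) : 2 * b < a * g ^ 2 := by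
  unfold Ham at h
  by_contra! hc
  nlinarith [mul_nonneg (sq_nonneg g) (sub_nonneg.2 hc)]

/-- While `g` is nonnegative, `f` can only cross zero downwards. -/
lemma IsSolOn.f_neg_of_g_nonneg {a b x : ℝ} {f g : ℝ → ℝ} (hb : 0 < b)
    (hsol : IsSolOn a b x f g (Ici 0)) (hH : ∀ r > 0, 0 < Ham a b (f r) (g r))
    {s t : ℝ} (hs : 0 < s) (hst : s < t) (hg : ∀ r ∈ Icc s t, 0 ≤ g r) (hfs : f s ≤ 0) :
    f t < 0 := by
  have hp : ∀ r ∈ Icc s t, 0 < r := fun r hr => hs.trans_le hr.1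
  refine neg_of_deriv_neg_at_zeros hst hfs
    (fun r hr => (hsol.2.2.2.2 r (hp r hr).le (hp r hr)).1) fun r hr h0 => ?_
  have h := hH r (hp r hr)
  rw [h0] at h
  have h2 := two_mul_lt_of_Ham_pos h
  have hg0 : 0 < g r := (hg r hr).lt_of_ne fun h3 => by
    rw [← h3] at h2
    linarith
  rw [h0]
  nlinarith

/-- Between two zeros of `f` there is a zero of `g`. -/
lemma IsSolOn.exists_g_zero {a b x : ℝ} {f g : ℝ → ℝ} (hb : 0 < b)
    (hsol : IsSolOn a b x f g (Ici 0)) (hH : ∀ r > 0, 0 < Ham a b (f r) (g r))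
    {s t : ℝ} (hs : 0 < s) (hst : s < t) (hfs : f s = 0) (hft : f t = 0) :
    ∃ r ∈ Icc s t, g r = 0 := by
  by_contra! hne
  have hc : ContinuousOn g (Icc s t) :=
    hsol.2.2.2.1.mono fun r hr => hs.le.trans hr.1
  have hsgn : (∀ r ∈ Icc s t, 0 ≤ g r) ∨ ∀ r ∈ Icc s t, g r ≤ 0 := by
    by_contra! hcon
    obtain ⟨⟨u, hu, hgu⟩, v, hv, hgv⟩ := hcon
    obtain ⟨r, hr, hr0⟩ := isPreconnected_Icc.intermediate_value hu hv hc ⟨hgu.le, hgv.le⟩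
    exact hne r hr hr0
  rcases hsgn with h | h
  · exact (hsol.f_neg_of_g_nonneg hb hH hs hst h hfs.le).ne hft
  · have := hsol.neg.f_neg_of_g_nonneg hb (fun r hr => by simpa [Ham_neg] using hH r hr) hs hst
      (fun r hr => by simpa using h r hr) (by simp [hfs])
    simp [hft] at this

/-- The value `g² = 1` is not reached. -/
lemma IsSolOn.g_sq_ne_one {a b x : ℝ} {f g : ℝ → ℝ} (hx : x ^ 2 ≠ 1)
    (hsol : IsSolOn a b x f g (Ici 0)) {t : ℝ} (ht : 0 ≤ t) : 1 - g t ^ 2 ≠ 0 := by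
  obtain ⟨-, h2, h3, h4, h5⟩ := hsol
  have hsub : Icc 0 t ⊆ Ici 0 := Icc_subset_Ici_self
  have hcf := h3.mono hsub
  have hcg := h4.mono hsub
  obtain ⟨C, hC⟩ := isCompact_Icc.exists_bound_of_continuousOn (hcg.mul hcf)
  have hmono : MonotoneOn (fun r => exp (4 * C * r) * (1 - g r ^ 2) ^ 2) (Icc 0 t) := by
    refine monotoneOn_of_hasDerivWithinAt_nonneg (convex_Icc 0 t)
      (f' := fun r => 4 * exp (4 * C * r) * (1 - g r ^ 2) ^ 2 * (C - g r * f r))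
      (by fun_prop) (fun r hr => ?_) fun r hr => ?_
    · rw [interior_Icc] at hr
      have hg := (h5 r hr.1.le hr.1).2
      have he : HasDerivAt (fun r => exp (4 * C * r)) (exp (4 * C * r) * (4 * C * 1)) r :=
        ((hasDerivAt_id r).const_mul (4 * C)).exp
      refine HasDerivAt.hasDerivWithinAt ?_
      refine (he.mul (((hg.pow 2).const_sub 1).pow 2)).congr_deriv ?_
      simp only [Pi.pow_apply]
      push_cast
      ring
    · rw [interior_Icc] at hr
      have : g r * f r ≤ C := (abs_le.1 (hC r (Ioo_subset_Icc_self hr))).2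
      have : 0 ≤ C - g r * f r := by linarith
      positivity
  intro h0
  have h := hmono (left_mem_Icc.2 ht) (right_mem_Icc.2 ht) ht
  have hpos : 0 < (1 - x ^ 2) ^ 2 := by
    have : 1 - x ^ 2 ≠ 0 := fun h => hx (by linarith)
    positivity
  simp only [h2, h0, mul_zero, exp_zero, one_mul] at h
  norm_num at h
  exact hx (by linarith)

/-- Before the first zero of `g`, `f` does not vanish. -/
lemma IsSolOn.exists_g_zero_before {a b x : ℝ} {f g : ℝ → ℝ} (hb : 0 < b) (hx : 0 < x)
    (hsol : IsSolOn a b x f g (Ici 0)) (hH : ∀ r > 0, 0 < Ham a b (f r) (g r))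
    {t : ℝ} (ht : 0 < t) (hft : f t = 0) : ∃ r ∈ Ioc 0 t, g r = 0 := by
  by_contra! hne
  obtain ⟨h1, h2, h3, h4, h5⟩ := id hsol
  have hg : ∀ r ∈ Icc 0 t, 0 ≤ g r := by
    intro r hr
    by_contra! hlt
    obtain ⟨u, hu, hu0⟩ := isPreconnected_Icc.intermediate_value hr (left_mem_Icc.2 ht.le)
      (h4.mono Icc_subset_Ici_self) ⟨hlt.le, (h2.trans_gt hx).le⟩
    rcases hu.1.eq_or_lt with h | h
    · rw [← h, h2] at hu0
      exact hx.ne' hu0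
    · exact hne u ⟨h, hu.2⟩ hu0
  have hfpos : ∀ s ∈ Ioo 0 t, 0 < f s := fun s hs => by
    by_contra! hle
    exact (hsol.f_neg_of_g_nonneg hb hH hs.1 hs.2
      (fun r hr => hg r ⟨hs.1.le.trans hr.1, hr.2⟩) hle).ne hft
  have tf : Tendsto f (𝓝[>] 0) (𝓝 0) := by
    have := (h3 0 self_mem_Ici).mono_left (nhdsWithin_mono 0 Ioi_subset_Ici_self)
    rwa [h1] at this
  have tg : Tendsto g (𝓝[>] 0) (𝓝 x) := by
    have := (h4 0 self_mem_Ici).mono_left (nhdsWithin_mono 0 Ioi_subset_Ici_self)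
    rwa [h2] at this
  have hH0 : 0 ≤ Ham a b 0 x := by
    have tH : Tendsto (fun r => Ham a b (f r) (g r)) (𝓝[>] 0) (𝓝 (Ham a b 0 x)) := by
      unfold Ham
      exact ((((tf.pow 2).const_mul _).mul ((tg.pow 2).const_sub 1)).add
        ((tg.pow 4).const_mul _)).sub ((tg.pow 2).const_mul _)
    exact ge_of_tendsto tH (eventually_nhdsWithin_of_forall fun r hr => (hH r hr).le)
  have hax : 2 * b ≤ a * x ^ 2 := by
    unfold Ham at hH0
    by_contra! hc
    nlinarith [mul_pos (pow_pos hx 2) (sub_pos.2 hc)]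
  have tF : Tendsto (fun r => f r ^ 2 - a * g r ^ 2 + b) (𝓝[>] 0) (𝓝 (0 ^ 2 - a * x ^ 2 + b)) :=
    ((tf.pow 2).sub ((tg.pow 2).const_mul a)).add_const b
  have hev := tF.eventually (gt_mem_nhds (show 0 ^ 2 - a * x ^ 2 + b < 0 by linarith))
  obtain ⟨ε, hε, hεs⟩ := mem_nhdsGT_iff_exists_Ioo_subset.1
    (inter_mem hev (Ioo_mem_nhdsGT ht))
  have hε0 : (0 : ℝ) < ε := hε
  have hmem : ε / 2 ∈ Ioo 0 ε := ⟨by linarith, by linarith⟩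
  obtain ⟨c, hc, hc'⟩ := exists_hasDerivAt_eq_slope f
    (fun r => g r * (f r ^ 2 - a * g r ^ 2 + b) - 2 / r * f r) hmem.1
    (h3.mono Icc_subset_Ici_self) (fun r hr => (h5 r hr.1.le hr.1).1)
  obtain ⟨hcF, hct⟩ := hεs (show c ∈ Ioo 0 ε from ⟨hc.1, hc.2.trans hmem.2⟩)
  have p1 : 0 < (f (ε / 2) - f 0) / (ε / 2 - 0) := by
    rw [h1, sub_zero, sub_zero]
    exact div_pos (hfpos _ (hεs hmem).2) hmem.1
  have p2 : 0 < 2 / c * f c := mul_pos (div_pos two_pos hc.1) (hfpos c hct)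
  have p3 : g c * (f c ^ 2 - a * g c ^ 2 + b) ≤ 0 :=
    mul_nonpos_of_nonneg_of_nonpos (hg c ⟨hc.1.le, hct.2.le⟩) hcF.le
  linarith

/-- Between two points where `g` takes the same value there is a zero of `f`. -/
lemma IsSolOn.exists_f_zero {a b x : ℝ} {f g : ℝ → ℝ} (hx : x ^ 2 ≠ 1)
    (hsol : IsSolOn a b x f g (Ici 0)) {s t : ℝ} (hs : 0 ≤ s) (hst : s < t)
    (hg : g s = g t) : ∃ r ∈ Ioo s t, f r = 0 := by
  have hp : ∀ r ∈ Ioo s t, 0 < r := fun r hr => hs.trans_lt hr.1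
  obtain ⟨r, hr, hr0⟩ := exists_hasDerivAt_eq_zero hst
    (hsol.2.2.2.1.mono fun r hr => hs.trans hr.1) hg
    (fun r hr => (hsol.2.2.2.2 r (hp r hr).le (hp r hr)).2)
  exact ⟨r, hr, (mul_eq_zero.1 hr0).resolve_right (hsol.g_sq_ne_one hx (hp r hr).le)⟩

/-- Rolle's argument at infinity: `f` vanishes after any zero of a decaying `g`. -/
lemma IsSolOn.exists_f_zero_after {a b x : ℝ} {f g : ℝ → ℝ} (hx : x ^ 2 ≠ 1)
    (hsol : IsSolOn a b x f g (Ici 0)) (hg : Tendsto g atTop (𝓝 0)) {s : ℝ} (hs : 0 ≤ s)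
    (hgs : g s = 0) : ∃ r > s, f r = 0 := by
  have hc := hsol.2.2.2.1
  by_cases hm : g (s + 1) = 0
  · obtain ⟨r, hr, h0⟩ := hsol.exists_f_zero hx hs (lt_add_one s) (hgs.trans hm.symm)
    exact ⟨r, hr.1, h0⟩
  have hm' : 0 < |g (s + 1)| := abs_pos.2 hm
  have hev : ∀ᶠ r in atTop, |g r| < |g (s + 1)| / 2 := by
    have := hg.abs
    rw [abs_zero] at this
    exact this.eventually (gt_mem_nhds (half_pos hm'))
  obtain ⟨q, hq, hsq⟩ := (hev.and (eventually_gt_atTop (s + 1))).exists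
  have hIcc1 : ContinuousOn g (Icc s (s + 1)) := hc.mono fun r hr => hs.trans hr.1
  have hIcc2 : ContinuousOn g (Icc (s + 1) q) := hc.mono fun r hr => by
    have := hr.1
    simp only [mem_Ici]
    linarith
  have key : ∃ u ∈ Icc s (s + 1), ∃ v ∈ Icc (s + 1) q, g u = g (s + 1) / 2 ∧
      g v = g (s + 1) / 2 := by
    have hs1 : s ≤ s + 1 := by linarith
    rcases lt_or_gt_of_ne hm with h | h
    · rw [abs_of_neg h] at hq
      have hq' := abs_lt.1 hq
      obtain ⟨u, hu, hu'⟩ := intermediate_value_Icc' hs1 hIcc1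
        (show g (s + 1) / 2 ∈ Icc _ _ from ⟨by linarith, by linarith⟩)
      obtain ⟨v, hv, hv'⟩ := intermediate_value_Icc hsq.le hIcc2
        (show g (s + 1) / 2 ∈ Icc _ _ from ⟨by linarith, by linarith⟩)
      exact ⟨u, hu, v, hv, hu', hv'⟩
    · rw [abs_of_pos h] at hq
      have hq' := abs_lt.1 hq
      obtain ⟨u, hu, hu'⟩ := intermediate_value_Icc hs1 hIcc1
        (show g (s + 1) / 2 ∈ Icc _ _ from ⟨by linarith, by linarith⟩)
      obtain ⟨v, hv, hv'⟩ := intermediate_value_Icc' hsq.le hIcc2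
        (show g (s + 1) / 2 ∈ Icc _ _ from ⟨by linarith, by linarith⟩)
      exact ⟨u, hu, v, hv, hu', hv'⟩
  obtain ⟨u, hu, v, hv, hgu, hgv⟩ := key
  have huv : u < v := lt_of_le_of_ne (hu.2.trans hv.1) fun h => hm (by
    have h1 : u = s + 1 := le_antisymm hu.2 (h ▸ hv.1)
    rw [h1] at hgu
    linarith)
  obtain ⟨r, hr, h0⟩ := hsol.exists_f_zero hx (hs.trans hu.1) huv (hgu.trans hgv.symm)
  exact ⟨r, hu.1.trans_lt hr.1, h0⟩

/-- Counting the points of a finite set interlaced with a strictly increasing sequence. -/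
lemma ncard_of_interlaced {k : ℕ} {p z : Fin k → ℝ} (hp : StrictMono p) (hpos : ∀ i, 0 < p i)
    (h1 : ∀ i, p i < z i) (h2 : ∀ i j, i < j → z i < p j) {P : ℝ → Prop}
    (hP : ∀ s > 0, P s ↔ ∃ i, z i = s) :
    ({r | r ∈ Ioi (0 : ℝ) ∧ P r}.Finite ∧ {r | r ∈ Ioi (0 : ℝ) ∧ P r}.ncard = k) ∧
    (∀ i : Fin k, {r | r ∈ Ioo (0 : ℝ) (p i) ∧ P r}.Finite ∧
      {r | r ∈ Ioo (0 : ℝ) (p i) ∧ P r}.ncard = (i : ℕ)) ∧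
    (∀ i : Fin k, (i : ℕ) = k - 1 →
      {r | p i < r ∧ P r}.Finite ∧ {r | p i < r ∧ P r}.ncard = 1) := by
  have hz : StrictMono z := fun i j hij => (h2 i j hij).trans (h1 j)
  have hz0 : ∀ i, 0 < z i := fun i => (hpos i).trans (h1 i)
  refine ⟨?_, fun i => ?_, fun i hi => ?_⟩
  · have : {r | r ∈ Ioi (0 : ℝ) ∧ P r} = z '' univ := by
      ext r
      simp only [mem_ofPred_eq, mem_Ioi, image_univ, mem_range]
      constructor
      · rintro ⟨hr, h⟩
        exact (hP r hr).1 h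
      · rintro ⟨i, rfl⟩
        exact ⟨hz0 i, (hP _ (hz0 i)).2 ⟨i, rfl⟩⟩
    rw [this, ncard_image_of_injective _ hz.injective]
    exact ⟨finite_univ.image z, by simp⟩
  · have : {r | r ∈ Ioo (0 : ℝ) (p i) ∧ P r} = z '' Iio i := by
      ext r
      simp only [mem_ofPred_eq, mem_Ioo, mem_image, mem_Iio]
      constructor
      · rintro ⟨⟨hr, hri⟩, h⟩
        obtain ⟨j, rfl⟩ := (hP r hr).1 h
        exact ⟨j, hp.lt_iff_lt.1 ((h1 j).trans hri), rfl⟩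
      · rintro ⟨j, hj, rfl⟩
        exact ⟨⟨hz0 j, h2 j i hj⟩, (hP _ (hz0 j)).2 ⟨j, rfl⟩⟩
    rw [this, ncard_image_of_injective _ hz.injective]
    refine ⟨(toFinite _).image z, ?_⟩
    rw [← Finset.coe_Iio, ncard_coe_finset, Fin.card_Iio]
  · have : {r | p i < r ∧ P r} = {z i} := by
      ext r
      simp only [mem_ofPred_eq, mem_singleton_iff]
      constructor
      · rintro ⟨hr, h⟩
        obtain ⟨j, rfl⟩ := (hP r ((hpos i).trans hr)).1 h
        rcases lt_trichotomy j i with hj | hj | hj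
        · exact absurd hr (h2 j i hj).not_gt
        · rw [hj]
        · have := j.2
          have : (i : ℕ) < j := hj
          omega
      · rintro rfl
        exact ⟨h1 i, (hP _ (hz0 i)).2 ⟨i, rfl⟩⟩
    rw [this]
    exact ⟨finite_singleton _, ncard_singleton _⟩

/-- interlacing of the zeros of `f` with the zeros of `g` for a
localized solution of the original system with positive energy. -/
theorem f_zeros_interlace (a b : ℝ) (hb : 0 < b) (hab : 2 * b < a)
    (x : ℝ) (hx : x ∈ Ioo (0 : ℝ) 1)
    (f g : ℝ → ℝ) (hsol : IsSolOn a b x f g (Ici 0))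
    (hH : ∀ r > 0, 0 < Ham a b (f r) (g r))
    (k : ℕ) (rz : Fin k → ℝ) (hmono : StrictMono rz) (hpos : ∀ i, 0 < rz i)
    (hzeros : ∀ s > 0, (g s = 0 ↔ ∃ i, rz i = s))
    (hconv : Tendsto (fun r => (f r, g r)) atTop (nhds ((0 : ℝ), (0 : ℝ)))) :
    ({r | r ∈ Ioi (0 : ℝ) ∧ f r = 0}.Finite ∧
      {r | r ∈ Ioi (0 : ℝ) ∧ f r = 0}.ncard = k) ∧
    (∀ i : Fin k, {r | r ∈ Ioo (0 : ℝ) (rz i) ∧ f r = 0}.Finite ∧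
      {r | r ∈ Ioo (0 : ℝ) (rz i) ∧ f r = 0}.ncard = (i : ℕ)) ∧
    (∀ i : Fin k, (i : ℕ) = k - 1 →
      {r | rz i < r ∧ f r = 0}.Finite ∧ {r | rz i < r ∧ f r = 0}.ncard = 1) := by
  have hx1 : x ^ 2 ≠ 1 := by nlinarith [hx.1, hx.2]
  have hfz : ∀ i, f (rz i) ≠ 0 := fun i h0 => by
    have := hH (rz i) (hpos i)
    rw [h0, (hzeros _ (hpos i)).2 ⟨i, rfl⟩] at this
    simp [Ham] at this
  have hgr : ∀ i, g (rz i) = 0 := fun i => (hzeros _ (hpos i)).2 ⟨i, rfl⟩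
  have hex : ∀ j, ∃ s, rz j < s ∧ f s = 0 ∧ ∀ i, j < i → s < rz i := by
    intro j
    by_cases hj : (j : ℕ) + 1 < k
    · obtain ⟨s, hs, h0⟩ := hsol.exists_f_zero hx1 (hpos j).le
        (hmono (show j < ⟨j + 1, hj⟩ from Nat.lt_succ_self _)) ((hgr j).trans (hgr _).symm)
      exact ⟨s, hs.1, h0, fun i hi => hs.2.trans_le (hmono.monotone (Nat.succ_le_of_lt hi))⟩
    · have hg : Tendsto g atTop (𝓝 0) := (Prod.tendsto_iff _ _).1 hconv |>.2
      obtain ⟨s, hs, h0⟩ := hsol.exists_f_zero_after hx1 hg (hpos j).le (hgr j)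
      refine ⟨s, hs, h0, fun i hi => ?_⟩
      have : (j : ℕ) < i := hi
      omega
  choose z hz1 hz0 hz2 using hex
  refine ncard_of_interlaced hmono hpos hz1 (fun i j hij => hz2 i j hij) fun s hs => ⟨?_, ?_⟩
  · intro hfs
    obtain ⟨u, hu, hgu⟩ := hsol.exists_g_zero_before hb hx.1 hH hs hfs
    obtain ⟨i₀, rfl⟩ := (hzeros u hu.1).1 hgu
    obtain ⟨j, hj, hjmax⟩ := (toFinite {i | rz i ≤ s}).exists_maximal ⟨i₀, hu.2⟩
    have hjs : rz j < s := lt_of_le_of_ne hj fun h => hfz j (h ▸ hfs)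
    have hlt : ∀ i, j < i → s < rz i := fun i hi => by
      by_contra! hle
      exact hi.not_ge (hjmax hle hi.le)
    refine ⟨j, ?_⟩
    have hno : ∀ r, rz j < r → (∀ i, j < i → r < rz i) → g r ≠ 0 := fun r hr hr' h0 => by
      obtain ⟨i, rfl⟩ := (hzeros r ((hpos j).trans hr)).1 h0
      exact (hr' i (hmono.lt_iff_lt.1 hr)).false
    rcases lt_trichotomy (z j) s with h | h | h
    · obtain ⟨r, hr, h0⟩ := hsol.exists_g_zero hb hH ((hpos j).trans (hz1 j)) h (hz0 j) hfs
      exact absurd h0 (hno r ((hz1 j).trans_le hr.1) fun i hi => hr.2.trans_lt (hlt i hi))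
    · exact h
    · obtain ⟨r, hr, h0⟩ := hsol.exists_g_zero hb hH hs h hfs (hz0 j)
      exact absurd h0 (hno r (hjs.trans_le hr.1) fun i hi => hr.2.trans_lt (hz2 j i hi))
  · rintro ⟨i, rfl⟩
    exact hz0 i
end
end
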